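/- Let k, l, r be positive integers and let U, Û ∈ ℝ^{(k+l)×r} satisfy UᵀU = ÛᵀÛ = I_r. Write M, M̂ ∈ ℝ^{k×r} for the submatrices of the first k rows of U, Û and Y_f, Ŷ_f ∈ ℝ^{l×r} for the last l rows. Let γ > 0 satisfy ‖M·x‖₂ ≥ γ·‖x‖₂ for all x ∈ ℝ^r. If κ := (1/√2)·‖UUᵀ − ÛÛᵀ‖_F ≤ γ/(2√2), then M̂ has full column rank, ‖M̂·x‖₂ ≥ (γ/2)·‖x‖₂ for all x ∈ ℝ^r, and for every b ∈ ℝ^k: ‖Ŷ_f·M̂†·b − Y_f·M†·b‖₂ ≤ (2(1+√5)/γ² + 1/γ)·√2·κ·‖b‖₂. -/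

import Mathlib

open Matrix BigOperators

/-- Euclidean norm of a real vector. -/
noncomputable def euclNorm {ι : Type*} [Fintype ι] (v : ι → ℝ) : ℝ :=
  Real.sqrt (∑ i, (v i) ^ 2)

/-- Frobenius norm of a real matrix. -/
noncomputable def frobNorm {ι κ : Type*} [Fintype ι] [Fintype κ] (M : Matrix ι κ ℝ) : ℝ :=
  Real.sqrt (∑ i, ∑ j, (M i j) ^ 2)

/-- Moore–Penrose pseudoinverse of a full-column-rank matrix: M† = (MᵀM)⁻¹Mᵀ. -/
noncomputable def pinv {ι κ : Type*} [Fintype ι] [Fintype κ] [DecidableEq κ]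
    (M : Matrix ι κ ℝ) : Matrix κ ι ℝ :=
  (Mᵀ * M)⁻¹ * Mᵀ

section EuclideanNorm

variable {ι κ : Type*} [Fintype ι] [Fintype κ]

lemma euclNorm_eq_norm (v : ι → ℝ) : euclNorm v = ‖WithLp.toLp 2 v‖ := by
  simp [euclNorm, EuclideanSpace.norm_eq]

lemma euclNorm_nonneg (v : ι → ℝ) : 0 ≤ euclNorm v := Real.sqrt_nonneg _

lemma euclNorm_sq (v : ι → ℝ) : euclNorm v ^ 2 = v ⬝ᵥ v := by
  rw [euclNorm, Real.sq_sqrt (Finset.sum_nonneg fun i _ => sq_nonneg _)]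
  simp [dotProduct, sq]

lemma euclNorm_eq_zero {v : ι → ℝ} : euclNorm v = 0 ↔ v = 0 := by
  simp [euclNorm_eq_norm]

lemma euclNorm_add_le (v w : ι → ℝ) : euclNorm (v + w) ≤ euclNorm v + euclNorm w := by
  simpa only [euclNorm_eq_norm, WithLp.toLp_add] using norm_add_le _ _

lemma euclNorm_sub_rev (v w : ι → ℝ) : euclNorm (v - w) = euclNorm (w - v) := by
  simpa only [euclNorm_eq_norm, WithLp.toLp_sub] using norm_sub_rev _ _

lemma dotProduct_le_euclNorm_mul (v w : ι → ℝ) : v ⬝ᵥ w ≤ euclNorm v * euclNorm w :=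
  Real.sum_mul_le_sqrt_mul_sqrt _ _ _

lemma euclNorm_comp_le (v : ι → ℝ) {f : κ → ι} (hf : Function.Injective f) :
    euclNorm (v ∘ f) ≤ euclNorm v := by
  classical
  refine Real.sqrt_le_sqrt ?_
  simp only [Function.comp_apply]
  rw [← Finset.sum_image (s := Finset.univ) (g := f) (f := fun i => v i ^ 2)
    (fun a _ b _ h => hf h)]
  exact Finset.sum_le_sum_of_subset_of_nonneg (Finset.subset_univ _) fun _ _ _ => sq_nonneg _

lemma euclNorm_mulVec_sq (A : Matrix ι κ ℝ) (x : κ → ℝ) :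
    euclNorm (A *ᵥ x) ^ 2 = x ⬝ᵥ (Aᵀ * A) *ᵥ x := by
  rw [euclNorm_sq, dotProduct_mulVec, ← mulVec_transpose, mulVec_mulVec, dotProduct_comm]

lemma frobNorm_nonneg (A : Matrix ι κ ℝ) : 0 ≤ frobNorm A := Real.sqrt_nonneg _

lemma frobNorm_sq (A : Matrix ι κ ℝ) : frobNorm A ^ 2 = (Aᵀ * A).trace := by
  rw [frobNorm, Real.sq_sqrt (by positivity), Finset.sum_comm]
  simp [trace, mul_apply, sq]

lemma frobNorm_sub_rev (A B : Matrix ι κ ℝ) : frobNorm (A - B) = frobNorm (B - A) := by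
  simp only [frobNorm, Matrix.sub_apply, sub_sq_comm]

lemma euclNorm_mulVec_le (A : Matrix ι κ ℝ) (x : κ → ℝ) :
    euclNorm (A *ᵥ x) ≤ frobNorm A * euclNorm x := by
  rw [euclNorm, euclNorm, frobNorm, ← Real.sqrt_mul (by positivity), Finset.sum_mul]
  exact Real.sqrt_le_sqrt (Finset.sum_le_sum fun i _ => Finset.sum_mul_sq_le_sq_mul_sq _ _ _)

lemma mulVec_injective_of_bound {M : Matrix ι κ ℝ} {c : ℝ} (hc : 0 < c)
    (hM : ∀ x, c * euclNorm x ≤ euclNorm (M *ᵥ x)) : Function.Injective M.mulVec := by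
  intro x y hxy
  have h := hM (x - y)
  rw [mulVec_sub, sub_eq_zero.2 hxy, euclNorm_eq_zero.2 rfl] at h
  have h0 : euclNorm (x - y) = 0 :=
    le_antisymm (nonpos_of_mul_nonpos_right h hc) (euclNorm_nonneg _)
  exact sub_eq_zero.1 (euclNorm_eq_zero.1 h0)

lemma euclNorm_submatrix_mulVec_sub_le {ι' : Type*} [Fintype ι'] (A B : Matrix ι κ ℝ)
    (C : Matrix κ κ ℝ) {f : ι' → ι} (hf : Function.Injective f) (x : κ → ℝ) :
    euclNorm (A.submatrix f id *ᵥ x - B.submatrix f id *ᵥ (C *ᵥ x))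
      ≤ frobNorm (A - B * C) * euclNorm x := by
  refine le_trans (le_of_eq_of_le ?_ (euclNorm_comp_le _ hf)) (euclNorm_mulVec_le (A - B * C) x)
  rw [sub_mulVec, ← mulVec_mulVec]
  rfl

end EuclideanNorm

section OrthonormalColumns

variable {ι κ : Type*} [Fintype ι] [Fintype κ] [DecidableEq κ]

/-- The chordal distance between two column spaces is the Frobenius norm of the part of one
orthonormal basis that is orthogonal to the other column space. -/
lemma frobNorm_proj_sub_proj {U V : Matrix ι κ ℝ} (hU : Uᵀ * U = 1) (hV : Vᵀ * V = 1) :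
    1 / √2 * frobNorm (U * Uᵀ - V * Vᵀ) = frobNorm (V - U * (Uᵀ * V)) := by
  refine (pow_left_inj₀ (mul_nonneg (by positivity) (frobNorm_nonneg _)) (frobNorm_nonneg _)
    two_ne_zero).1 ?_
  have hUU (W : Matrix κ κ ℝ) : Uᵀ * (U * W) = W := by rw [← Matrix.mul_assoc, hU, Matrix.one_mul]
  have hUU' (W : Matrix κ ι ℝ) : Uᵀ * (U * W) = W := by
    rw [← Matrix.mul_assoc, hU, Matrix.one_mul]
  have hVV (W : Matrix κ ι ℝ) : Vᵀ * (V * W) = W := by rw [← Matrix.mul_assoc, hV, Matrix.one_mul]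
  have h1 : (U * Uᵀ).trace = (1 : Matrix κ κ ℝ).trace := by rw [trace_mul_comm, hU]
  have h2 : (V * Vᵀ).trace = (1 : Matrix κ κ ℝ).trace := by rw [trace_mul_comm, hV]
  have h3 : (U * (Uᵀ * (V * Vᵀ))).trace = (Vᵀ * (U * (Uᵀ * V))).trace := by
    rw [← Matrix.mul_assoc, ← Matrix.mul_assoc, trace_mul_comm, Matrix.mul_assoc]
  have h4 : (V * (Vᵀ * (U * Uᵀ))).trace = (Vᵀ * (U * (Uᵀ * V))).trace := by
    rw [trace_mul_comm]
    simp only [Matrix.mul_assoc]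
  rw [mul_pow, frobNorm_sq, frobNorm_sq, div_pow, Real.sq_sqrt zero_le_two]
  simp only [transpose_sub, transpose_mul, transpose_transpose, Matrix.sub_mul, Matrix.mul_sub,
    Matrix.mul_assoc, hUU, hUU', hVV, hV, trace_sub, h1, h2, h3, h4]
  ring

lemma euclNorm_mulVec_of_orthonormal {U : Matrix ι κ ℝ} (hU : Uᵀ * U = 1) (x : κ → ℝ) :
    euclNorm (U *ᵥ x) = euclNorm x := by
  refine (pow_left_inj₀ (euclNorm_nonneg _) (euclNorm_nonneg _) two_ne_zero).1 ?_
  rw [euclNorm_mulVec_sq, hU, one_mulVec, euclNorm_sq]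

/-- Pythagoras for the orthogonal projection of `V x` onto the column space of `U`. -/
lemma euclNorm_sq_eq_proj_add {U V : Matrix ι κ ℝ} (hU : Uᵀ * U = 1) (hV : Vᵀ * V = 1)
    (x : κ → ℝ) :
    euclNorm x ^ 2
      = euclNorm ((Uᵀ * V) *ᵥ x) ^ 2 + euclNorm ((V - U * (Uᵀ * V)) *ᵥ x) ^ 2 := by
  have hUU (W : Matrix κ κ ℝ) : Uᵀ * (U * W) = W := by rw [← Matrix.mul_assoc, hU, Matrix.one_mul]
  rw [euclNorm_mulVec_sq, euclNorm_mulVec_sq, ← dotProduct_add, ← add_mulVec]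
  simp only [transpose_sub, transpose_mul, transpose_transpose, Matrix.sub_mul, Matrix.mul_sub,
    Matrix.mul_assoc, hUU, hV, sub_self, sub_zero, add_sub_cancel, one_mulVec, euclNorm_sq]

end OrthonormalColumns

section Pseudoinverse

variable {ι κ : Type*} [Fintype ι] [Fintype κ] [DecidableEq κ]

/-- The normal equations satisfied by `M† b`. -/
lemma transpose_mulVec_sub_pinv {M : Matrix ι κ ℝ} (hM : Function.Injective M.mulVec)
    (b : ι → ℝ) : Mᵀ *ᵥ (b - M *ᵥ (pinv M *ᵥ b)) = 0 := by
  have hunit : IsUnit (Mᵀ * M) := by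
    rw [← mulVec_injective_iff_isUnit]
    intro x y hxy
    apply hM
    have h : euclNorm (M *ᵥ (x - y)) ^ 2 = 0 := by
      rw [euclNorm_mulVec_sq, mulVec_sub, sub_eq_zero.2 hxy, dotProduct_zero]
    rw [sq_eq_zero_iff, euclNorm_eq_zero, mulVec_sub] at h
    exact sub_eq_zero.1 h
  rw [mulVec_sub, mulVec_mulVec, mulVec_mulVec, pinv, ← Matrix.mul_assoc,
    Matrix.mul_nonsing_inv _ ((isUnit_iff_isUnit_det _).1 hunit), Matrix.one_mul, sub_self]

lemma dotProduct_residual_eq_zero {M : Matrix ι κ ℝ} (hM : Function.Injective M.mulVec)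
    (b : ι → ℝ) (x : κ → ℝ) : M *ᵥ x ⬝ᵥ (b - M *ᵥ (pinv M *ᵥ b)) = 0 := by
  rw [dotProduct_comm, dotProduct_mulVec, ← mulVec_transpose, transpose_mulVec_sub_pinv hM,
    zero_dotProduct]

lemma euclNorm_sq_eq_residual_add {M : Matrix ι κ ℝ} (hM : Function.Injective M.mulVec)
    (b : ι → ℝ) :
    euclNorm b ^ 2
      = euclNorm (M *ᵥ (pinv M *ᵥ b)) ^ 2 + euclNorm (b - M *ᵥ (pinv M *ᵥ b)) ^ 2 := by
  have h := dotProduct_residual_eq_zero hM b (pinv M *ᵥ b)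
  simp only [euclNorm_sq, dotProduct_sub, sub_dotProduct] at h ⊢
  have := dotProduct_comm b (M *ᵥ (pinv M *ᵥ b))
  linarith

lemma euclNorm_mulVec_pinv_le {M : Matrix ι κ ℝ} (hM : Function.Injective M.mulVec) (b : ι → ℝ) :
    euclNorm (M *ᵥ (pinv M *ᵥ b)) ≤ euclNorm b :=
  pow_le_pow_iff_left₀ (euclNorm_nonneg _) (euclNorm_nonneg _) two_ne_zero |>.1 <| by
    nlinarith [euclNorm_sq_eq_residual_add hM b, sq_nonneg (euclNorm (b - M *ᵥ (pinv M *ᵥ b)))]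

lemma euclNorm_residual_le {M : Matrix ι κ ℝ} (hM : Function.Injective M.mulVec) (b : ι → ℝ) :
    euclNorm (b - M *ᵥ (pinv M *ᵥ b)) ≤ euclNorm b :=
  pow_le_pow_iff_left₀ (euclNorm_nonneg _) (euclNorm_nonneg _) two_ne_zero |>.1 <| by
    nlinarith [euclNorm_sq_eq_residual_add hM b, sq_nonneg (euclNorm (M *ᵥ (pinv M *ᵥ b)))]

/-- Perturbation bound for least squares: if `M' C ≈ M` and `M C' ≈ M'` up to `δ`, then the
least-squares solution for `M` is close to the `C'`-image of the one for `M'`. -/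
lemma euclNorm_pinv_sub_le {M M' : Matrix ι κ ℝ} {C C' : Matrix κ κ ℝ} {c c' δ : ℝ}
    (hc : 0 < c) (hc' : 0 < c') (hδ : 0 ≤ δ)
    (hM : ∀ x, c * euclNorm x ≤ euclNorm (M *ᵥ x))
    (hM' : ∀ x, c' * euclNorm x ≤ euclNorm (M' *ᵥ x))
    (hC : ∀ x, euclNorm (M *ᵥ x - M' *ᵥ (C *ᵥ x)) ≤ δ * euclNorm x)
    (hC' : ∀ x, euclNorm (M' *ᵥ x - M *ᵥ (C' *ᵥ x)) ≤ δ * euclNorm x) (b : ι → ℝ) :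
    euclNorm (pinv M *ᵥ b - C' *ᵥ (pinv M' *ᵥ b))
      ≤ (1 / c * (1 / c' + 1 / c)) * δ * euclNorm b := by
  have hinj := mulVec_injective_of_bound hc hM
  have hinj' := mulVec_injective_of_bound hc' hM'
  set x := pinv M *ᵥ b with hx
  set y := pinv M' *ᵥ b with hy
  set d := x - C' *ᵥ y with hd
  have hyb : euclNorm y ≤ 1 / c' * euclNorm b := by
    have := (hM' y).trans (euclNorm_mulVec_pinv_le hinj' b)
    rw [one_div_mul_eq_div, le_div_iff₀' hc']
    exact this
  have hdM : euclNorm d ≤ 1 / c * euclNorm (M *ᵥ d) := by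
    rw [one_div_mul_eq_div, le_div_iff₀' hc]
    exact hM d
  have hsq : euclNorm (M *ᵥ d) ^ 2
      = M *ᵥ d ⬝ᵥ (M' *ᵥ y - M *ᵥ (C' *ᵥ y))
        + (M *ᵥ d - M' *ᵥ (C *ᵥ d)) ⬝ᵥ (b - M' *ᵥ y) := by
    have h1 := dotProduct_residual_eq_zero hinj b d
    have h2 := dotProduct_residual_eq_zero hinj' b (C *ᵥ d)
    rw [← hx] at h1
    rw [← hy] at h2
    have h3 : M *ᵥ d = M *ᵥ x - M *ᵥ (C' *ᵥ y) := by rw [hd, mulVec_sub]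
    rw [euclNorm_sq, sub_dotProduct, h2]
    simp only [h3, dotProduct_sub, sub_dotProduct] at h1 ⊢
    linarith
  have hMd : euclNorm (M *ᵥ d) ≤ (1 / c' + 1 / c) * δ * euclNorm b := by
    have hn := euclNorm_nonneg (M *ᵥ d)
    have hnb := euclNorm_nonneg b
    have e1 : M *ᵥ d ⬝ᵥ (M' *ᵥ y - M *ᵥ (C' *ᵥ y))
        ≤ euclNorm (M *ᵥ d) * (δ * (1 / c' * euclNorm b)) :=
      (dotProduct_le_euclNorm_mul _ _).trans (by gcongr; exact (hC' y).trans (by gcongr))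
    have e2 : (M *ᵥ d - M' *ᵥ (C *ᵥ d)) ⬝ᵥ (b - M' *ᵥ y)
        ≤ δ * (1 / c * euclNorm (M *ᵥ d)) * euclNorm b :=
      (dotProduct_le_euclNorm_mul _ _).trans (mul_le_mul ((hC d).trans (by gcongr))
        (euclNorm_residual_le hinj' b) (euclNorm_nonneg _) (by positivity))
    rcases hn.eq_or_lt with h0 | h0
    · rw [← h0]; positivity
    · refine le_of_mul_le_mul_left ?_ h0
      linarith
  calc euclNorm d ≤ 1 / c * euclNorm (M *ᵥ d) := hdM
    _ ≤ 1 / c * ((1 / c' + 1 / c) * δ * euclNorm b) := by gcongr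
    _ = _ := by ring

end Pseudoinverse

/-- matrix-level content of Theorem 1: local Lipschitz continuity of the
subspace predictor in the chordal distance, for orthonormal bases `U`, `Û`. -/
theorem subspace_predictor_local_lipschitz
    (k l r : ℕ) (hk : 0 < k) (hl : 0 < l) (hr : 0 < r)
    (U Uh : Matrix (Fin (k + l)) (Fin r) ℝ)
    (hU : Uᵀ * U = 1) (hUh : Uhᵀ * Uh = 1)
    (γ : ℝ) (hγ : 0 < γ)
    (hM : ∀ x : Fin r → ℝ,
      γ * euclNorm x ≤ euclNorm ((U.submatrix (Fin.castAdd l) id).mulVec x))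
    (κ : ℝ) (hκdef : κ = (1 / Real.sqrt 2) * frobNorm (U * Uᵀ - Uh * Uhᵀ))
    (hκ : κ ≤ γ / (2 * Real.sqrt 2)) :
    (Uh.submatrix (Fin.castAdd l) id).rank = r ∧
    (∀ x : Fin r → ℝ,
      (γ / 2) * euclNorm x ≤ euclNorm ((Uh.submatrix (Fin.castAdd l) id).mulVec x)) ∧
    ∀ b : Fin k → ℝ,
      euclNorm
        (((Uh.submatrix (Fin.natAdd k) id) * pinv (Uh.submatrix (Fin.castAdd l) id)).mulVec b -
         ((U.submatrix (Fin.natAdd k) id) * pinv (U.submatrix (Fin.castAdd l) id)).mulVec b)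
      ≤ (2 * (1 + Real.sqrt 5) / γ ^ 2 + 1 / γ) * Real.sqrt 2 * κ * euclNorm b := by
  obtain ⟨hκ1, hκ2⟩ : κ = frobNorm (Uh - U * (Uᵀ * Uh)) ∧ κ = frobNorm (U - Uh * (Uhᵀ * U)) :=
    ⟨hκdef.trans (frobNorm_proj_sub_proj hU hUh), by
      rw [hκdef, frobNorm_sub_rev, frobNorm_proj_sub_proj hUh hU]⟩
  have hκ0 : 0 ≤ κ := hκ1 ▸ frobNorm_nonneg _
  have htop := Fin.castAdd_injective k l
  have hbot := Fin.natAdd_injective l k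
  set M := U.submatrix (Fin.castAdd l) id
  set Y := U.submatrix (Fin.natAdd k) id
  set Mh := Uh.submatrix (Fin.castAdd l) id
  set Yh := Uh.submatrix (Fin.natAdd k) id
  have hres (x : Fin r → ℝ) : euclNorm ((Uh - U * (Uᵀ * Uh)) *ᵥ x) ≤ κ * euclNorm x :=
    hκ1 ▸ euclNorm_mulVec_le _ _
  have hC (x : Fin r → ℝ) : euclNorm (Mh *ᵥ x - M *ᵥ ((Uᵀ * Uh) *ᵥ x)) ≤ κ * euclNorm x :=
    hκ1 ▸ euclNorm_submatrix_mulVec_sub_le Uh U (Uᵀ * Uh) htop x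
  have hC' (x : Fin r → ℝ) : euclNorm (M *ᵥ x - Mh *ᵥ ((Uhᵀ * U) *ᵥ x)) ≤ κ * euclNorm x :=
    hκ2 ▸ euclNorm_submatrix_mulVec_sub_le U Uh (Uhᵀ * U) htop x
  have hCY (x : Fin r → ℝ) : euclNorm (Yh *ᵥ ((Uhᵀ * U) *ᵥ x) - Y *ᵥ x) ≤ κ * euclNorm x := by
    rw [euclNorm_sub_rev]
    exact hκ2 ▸ euclNorm_submatrix_mulVec_sub_le U Uh (Uhᵀ * U) hbot x
  have hYh (x : Fin r → ℝ) : euclNorm (Yh *ᵥ x) ≤ euclNorm x :=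
    (euclNorm_comp_le (Uh *ᵥ x) hbot).trans_eq (euclNorm_mulVec_of_orthonormal hUh x)
  have hγ1 : γ ≤ 1 := by
    let e : Fin r → ℝ := Pi.single ⟨0, hr⟩ 1
    have he : 0 < euclNorm e := (euclNorm_nonneg _).lt_of_ne' fun h => by
      simpa [e] using congrFun (euclNorm_eq_zero.1 h) ⟨0, hr⟩
    have h := ((hM e).trans (euclNorm_comp_le (U *ᵥ e) htop)).trans_eq
      (euclNorm_mulVec_of_orthonormal hU e)
    exact le_of_mul_le_mul_right (by linarith) he
  have h2 : (7 / 5 : ℝ) ≤ √2 := Real.le_sqrt_of_sq_le (by norm_num)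
  have hκγ : κ ≤ 5 / 14 * γ := hκ.trans <| by
    rw [div_le_iff₀ (by positivity)]
    nlinarith
  have hproj (x : Fin r → ℝ) : 9 / 10 * euclNorm x ≤ euclNorm ((Uᵀ * Uh) *ᵥ x) := by
    refine (pow_le_pow_iff_left₀ (mul_nonneg (by norm_num) (euclNorm_nonneg _))
      (euclNorm_nonneg _) two_ne_zero).1 ?_
    have h := euclNorm_sq_eq_proj_add hU hUh x
    have h' := pow_le_pow_left₀ (euclNorm_nonneg _)
      ((hres x).trans (mul_le_mul_of_nonneg_right (show κ ≤ 5 / 14 by linarith)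
        (euclNorm_nonneg x))) 2
    nlinarith [sq_nonneg (euclNorm x)]
  have hMh (x : Fin r → ℝ) : γ / 2 * euclNorm x ≤ euclNorm (Mh *ᵥ x) := by
    have h3 : euclNorm (M *ᵥ ((Uᵀ * Uh) *ᵥ x))
        ≤ euclNorm (M *ᵥ ((Uᵀ * Uh) *ᵥ x) - Mh *ᵥ x) + euclNorm (Mh *ᵥ x) := by
      simpa using euclNorm_add_le (M *ᵥ ((Uᵀ * Uh) *ᵥ x) - Mh *ᵥ x) (Mh *ᵥ x)
    rw [euclNorm_sub_rev] at h3
    have h4 := mul_le_mul_of_nonneg_left (hproj x) hγ.le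
    have h5 := mul_le_mul_of_nonneg_right hκγ (euclNorm_nonneg x)
    have h6 := mul_nonneg hγ.le (euclNorm_nonneg x)
    linarith [hM ((Uᵀ * Uh) *ᵥ x), hC x]
  refine ⟨?_, hMh, fun b => ?_⟩
  · have h := mulVec_injective_of_bound (half_pos hγ) hMh
    rw [mulVec_injective_iff] at h
    simpa using h.rank_matrix
  · have hnb := euclNorm_nonneg b
    have hd := euclNorm_pinv_sub_le (half_pos hγ) hγ hκ0 hMh hM hC hC' b
    have hy : euclNorm (pinv M *ᵥ b) ≤ 1 / γ * euclNorm b := by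
      rw [one_div_mul_eq_div, le_div_iff₀' hγ]
      exact (hM _).trans (euclNorm_mulVec_pinv_le (mulVec_injective_of_bound hγ hM) b)
    have hsplit : (Yh * pinv Mh) *ᵥ b - (Y * pinv M) *ᵥ b
        = Yh *ᵥ (pinv Mh *ᵥ b - (Uhᵀ * U) *ᵥ (pinv M *ᵥ b))
          + (Yh *ᵥ ((Uhᵀ * U) *ᵥ (pinv M *ᵥ b)) - Y *ᵥ (pinv M *ᵥ b)) := by
      rw [mulVec_sub, sub_add_sub_cancel, mulVec_mulVec, mulVec_mulVec]
    have h5 : (2 : ℝ) ≤ √5 := Real.le_sqrt_of_sq_le (by norm_num)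
    have hcoef : 6 / γ ^ 2 + 1 / γ ≤ (2 * (1 + √5) / γ ^ 2 + 1 / γ) * √2 :=
      calc 6 / γ ^ 2 + 1 / γ ≤ (2 * (1 + √5) / γ ^ 2 + 1 / γ) * 1 := by
            rw [mul_one]; gcongr; linarith
        _ ≤ _ := by gcongr; linarith
    calc _ ≤ 1 / (γ / 2) * (1 / γ + 1 / (γ / 2)) * κ * euclNorm b
            + κ * (1 / γ * euclNorm b) := by
          rw [hsplit]
          refine (euclNorm_add_le _ _).trans (add_le_add ((hYh _).trans hd) ((hCY _).trans ?_))
          gcongr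
      _ = (6 / γ ^ 2 + 1 / γ) * (κ * euclNorm b) := by field_simp; ring
      _ ≤ (2 * (1 + √5) / γ ^ 2 + 1 / γ) * √2 * (κ * euclNorm b) := by gcongr
      _ = _ := by ring
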